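/- Let X be a 2m×2m antisymmetric matrix written in block form with a bottom-right 2×2 block [[0, s],[-s, 0]] where s is invertible, top-right 2(m-1)×2 block with columns u and v, and top-left block A. Then Pf[X] = s·Pf[A'] where A'_{ij} = A_{ij} - (u_i v_j - v_i u_j)/s; i.e., one can reduce the last pair of rows/columns of a Pfaffian by a rank-2 update, analogous to Gaussian elimination for determinants. -/

import Mathlib

open Matrix BigOperators

/-- The set of permutations giving the distinct terms in the Pfaffian sum:
those `σ` with `σ(2k) < σ(2k+1)` for each `k` and `σ(0) < σ(2) < σ(4) < ⋯`. -/
def pfPerms (n : ℕ) : Finset (Equiv.Perm (Fin (2 * n))) :=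
  Finset.univ.filter (fun σ =>
    (∀ k : Fin n, σ ⟨2 * k.1, by omega⟩ < σ ⟨2 * k.1 + 1, by omega⟩) ∧
    (∀ k l : Fin n, k < l → σ ⟨2 * k.1, by omega⟩ < σ ⟨2 * l.1, by omega⟩))

/-- The Pfaffian of a `2n × 2n` matrix over a commutative ring, defined as the
sum over distinct perfect matchings with signs. -/
def pf {R : Type*} [CommRing R] {n : ℕ} (X : Matrix (Fin (2 * n)) (Fin (2 * n)) R) : R :=
  ∑ σ ∈ pfPerms n, (Equiv.Perm.sign σ : ℤ) •
    ∏ k : Fin n, X (σ ⟨2 * k.1, by omega⟩) (σ ⟨2 * k.1 + 1, by omega⟩)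


/-- Positions in `Fin (2 * n)` as pairs (index of the matched pair, place in that pair). -/
def pairPos (n : ℕ) : Fin n × Fin 2 ≃ Fin (2 * n) :=
  finProdFinEquiv.trans (finCongr (Nat.mul_comm n 2))

lemma pairPos_zero {n : ℕ} (k : Fin n) : pairPos n (k, 0) = ⟨2 * k.1, by omega⟩ := by
  ext; simp [pairPos, finProdFinEquiv]

lemma pairPos_one {n : ℕ} (k : Fin n) : pairPos n (k, 1) = ⟨2 * k.1 + 1, by omega⟩ := by
  ext; simp [pairPos, finProdFinEquiv]; omega

/-- The summand of the Pfaffian attached to a permutation. -/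
def pfTerm {R : Type*} [CommRing R] {n : ℕ} (X : Matrix (Fin (2 * n)) (Fin (2 * n)) R)
    (σ : Equiv.Perm (Fin (2 * n))) : R :=
  (Equiv.Perm.sign σ : ℤ) • ∏ k : Fin n, X (σ (pairPos n (k, 0))) (σ (pairPos n (k, 1)))

lemma pf_eq_sum_pfTerm {R : Type*} [CommRing R] {n : ℕ}
    (X : Matrix (Fin (2 * n)) (Fin (2 * n)) R) : pf X = ∑ σ ∈ pfPerms n, pfTerm X σ := by
  simp only [pf, pfTerm, pairPos_zero, pairPos_one]

lemma mem_pfPerms {n : ℕ} {σ : Equiv.Perm (Fin (2 * n))} :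
    σ ∈ pfPerms n ↔ (∀ k, σ (pairPos n (k, 0)) < σ (pairPos n (k, 1))) ∧
      StrictMono fun k => σ (pairPos n (k, 0)) := by
  simp only [pfPerms, Finset.mem_filter, Finset.mem_univ, true_and, pairPos_zero, pairPos_one,
    StrictMono]

/-- The permutation of positions which permutes the pairs by `h.2` and permutes within the pairs
by `h.1`. -/
def pairPerm {n : ℕ} (h : (Fin n → Equiv.Perm (Fin 2)) × Equiv.Perm (Fin n)) :
    Equiv.Perm (Fin (2 * n)) :=
  (pairPos n).permCongr
    ((Equiv.prodCongrLeft fun _ : Fin 2 => h.2).trans (Equiv.prodCongrRight h.1))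

lemma pairPerm_apply {n : ℕ} (h : (Fin n → Equiv.Perm (Fin 2)) × Equiv.Perm (Fin n))
    (k : Fin n) (b : Fin 2) :
    pairPerm h (pairPos n (k, b)) = pairPos n (h.2 k, h.1 (h.2 k) b) := by
  simp [pairPerm, Equiv.permCongr_apply]

lemma sign_pairPerm {n : ℕ} (h : (Fin n → Equiv.Perm (Fin 2)) × Equiv.Perm (Fin n)) :
    Equiv.Perm.sign (pairPerm h) = ∏ k, Equiv.Perm.sign (h.1 k) := by
  rw [pairPerm, Equiv.Perm.sign_permCongr, Equiv.Perm.sign_trans,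
    Equiv.Perm.sign_prodCongrLeft, Equiv.Perm.sign_prodCongrRight]
  simp

lemma Equiv.Perm.fin_two_eq (e : Equiv.Perm (Fin 2)) : e = 1 ∨ e = Equiv.swap 0 1 := by
  revert e; decide

lemma pfTerm_mul_pairPerm {R : Type*} [CommRing R] {n : ℕ}
    {X : Matrix (Fin (2 * n)) (Fin (2 * n)) R} (hX : Xᵀ = -X) (σ : Equiv.Perm (Fin (2 * n)))
    (h : (Fin n → Equiv.Perm (Fin 2)) × Equiv.Perm (Fin n)) :
    pfTerm X (σ * pairPerm h) = pfTerm X σ := by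
  have hX' : ∀ i j, X j i = -X i j := fun i j => congrFun (congrFun hX i) j
  have key : ∀ k : Fin n, ((Equiv.Perm.sign (h.1 k) : ℤ) : R) *
      X (σ (pairPos n (k, h.1 k 0))) (σ (pairPos n (k, h.1 k 1))) =
      X (σ (pairPos n (k, 0))) (σ (pairPos n (k, 1))) := by
    intro k
    rcases Equiv.Perm.fin_two_eq (h.1 k) with e | e <;> rw [e]
    · simp
    · rw [hX']; simp
  simp only [pfTerm, Equiv.Perm.mul_apply, pairPerm_apply, map_mul, sign_pairPerm, zsmul_eq_mul]
  rw [Equiv.prod_comp h.2 fun k =>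
    X (σ (pairPos n (k, h.1 k 0))) (σ (pairPos n (k, h.1 k 1)))]
  push_cast
  rw [mul_assoc, ← Finset.prod_mul_distrib]
  simp only [key]

lemma existsUnique_pairPerm {n : ℕ} (σ : Equiv.Perm (Fin (2 * n))) :
    ∃! h : (Fin n → Equiv.Perm (Fin 2)) × Equiv.Perm (Fin n), σ * pairPerm h ∈ pfPerms n := by
  simp only [mem_pfPerms, Equiv.Perm.mul_apply, pairPerm_apply]
  have hne : ∀ k, σ (pairPos n (k, 0)) ≠ σ (pairPos n (k, 1)) := by
    intro k; simp
  have horder : ∀ k, ∃ e : Equiv.Perm (Fin 2),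
      σ (pairPos n (k, e 0)) < σ (pairPos n (k, e 1)) := by
    intro k
    rcases lt_or_gt_of_ne (hne k) with hk | hk
    · exact ⟨1, by simpa using hk⟩
    · exact ⟨Equiv.swap 0 1, by simpa using hk⟩
  have hunique : ∀ k (e e' : Equiv.Perm (Fin 2)),
      σ (pairPos n (k, e 0)) < σ (pairPos n (k, e 1)) →
      σ (pairPos n (k, e' 0)) < σ (pairPos n (k, e' 1)) → e = e' := by
    intro k e e' h h'
    rcases Equiv.Perm.fin_two_eq e with rfl | rfl <;>
      rcases Equiv.Perm.fin_two_eq e' with rfl | rfl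
    · rfl
    · simp at h h'; exact absurd h h'.asymm
    · simp at h h'; exact absurd h h'.asymm
    · rfl
  choose e he using horder
  have hinj : Function.Injective fun k => σ (pairPos n (k, e k 0)) := by
    intro k l hkl
    simpa using congrArg Prod.fst ((pairPos n).injective (σ.injective hkl))
  refine ⟨(e, Tuple.sort fun k => σ (pairPos n (k, e k 0))), ⟨fun k => he _, ?_⟩, ?_⟩
  · exact (Tuple.monotone_sort fun k => σ (pairPos n (k, e k 0))).strictMono_of_injective
      (hinj.comp (Equiv.injective _))
  · rintro ⟨e', τ⟩ ⟨h₁, h₂⟩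
    obtain rfl : e' = e := by
      funext k
      refine hunique k _ _ ?_ (he k)
      simpa using h₁ (τ.symm k)
    congr 1
    exact Tuple.eq_sort_iff.2 ⟨h₂.monotone, fun i j hij hf => absurd hf (h₂ hij).ne⟩

lemma sum_pfTerm {R : Type*} [CommRing R] {n : ℕ}
    {X : Matrix (Fin (2 * n)) (Fin (2 * n)) R} (hX : Xᵀ = -X) :
    ∑ σ, pfTerm X σ = (2 ^ n * n.factorial : ℕ) * pf X := by
  have h₁ : ∀ σ, pfTerm X σ = ∑ h : (Fin n → Equiv.Perm (Fin 2)) × Equiv.Perm (Fin n),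
      if σ * pairPerm h ∈ pfPerms n then pfTerm X (σ * pairPerm h) else 0 := by
    intro σ
    obtain ⟨h, hh, hu⟩ := existsUnique_pairPerm σ
    rw [Finset.sum_eq_single h, if_pos hh, pfTerm_mul_pairPerm hX]
    · intro h' _ hne
      exact if_neg fun hh' => hne (hu h' hh')
    · simp
  have h₂ : ∀ h : (Fin n → Equiv.Perm (Fin 2)) × Equiv.Perm (Fin n),
      (∑ σ, if σ * pairPerm h ∈ pfPerms n then pfTerm X (σ * pairPerm h) else 0) = pf X := by
    intro h
    refine (Equiv.sum_comp (Equiv.mulRight (pairPerm h))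
      (fun σ => if σ ∈ pfPerms n then pfTerm X σ else 0)).trans ?_
    rw [pf_eq_sum_pfTerm, Finset.sum_ite_mem, Finset.univ_inter]
  rw [Finset.sum_congr rfl fun σ _ => h₁ σ, Finset.sum_comm, Finset.sum_congr rfl fun h _ => h₂ h]
  simp [Fintype.card_perm]

/-- The map `Fin (2 * n) → ι` listing the entries of the pairs `g k` consecutively. -/
def unpair {ι : Type*} {n : ℕ} (g : Fin n → ι × ι) (p : Fin (2 * n)) : ι :=
  if ((pairPos n).symm p).2 = 0 then (g ((pairPos n).symm p).1).1
  else (g ((pairPos n).symm p).1).2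

lemma sum_pfTerm_conj_eq_sum_det {R : Type*} [CommRing R] {n : ℕ}
    (B X : Matrix (Fin (2 * n)) (Fin (2 * n)) R) :
    ∑ σ, pfTerm (B * X * Bᵀ) σ =
      ∑ g : Fin n → Fin (2 * n) × Fin (2 * n),
        (∏ k, X (g k).1 (g k).2) * (B.submatrix id (unpair g)).det := by
  have hentry : ∀ i j, (B * X * Bᵀ) i j =
      ∑ q : Fin (2 * n) × Fin (2 * n), X q.1 q.2 * (B i q.1 * B j q.2) := by
    intro i j
    simp only [Matrix.mul_apply, Matrix.transpose_apply, Finset.sum_mul]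
    rw [Finset.sum_comm, Fintype.sum_prod_type]
    refine Finset.sum_congr rfl fun a _ => Finset.sum_congr rfl fun b _ => ?_
    ring
  simp only [pfTerm, hentry, Finset.prod_univ_sum, Fintype.piFinset_univ, Finset.smul_sum]
  rw [Finset.sum_comm]
  refine Finset.sum_congr rfl fun g _ => ?_
  rw [Matrix.det_apply, Finset.mul_sum]
  refine Finset.sum_congr rfl fun σ _ => ?_
  rw [← Equiv.prod_comp (pairPos n), Fintype.prod_prod_type, Finset.prod_mul_distrib,
    Units.smul_def, mul_smul_comm]
  simp [unpair, Fin.prod_univ_two]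

lemma sum_pfTerm_conj {R : Type*} [CommRing R] {n : ℕ}
    (B X : Matrix (Fin (2 * n)) (Fin (2 * n)) R) :
    ∑ σ, pfTerm (B * X * Bᵀ) σ = B.det * ∑ σ, pfTerm X σ := by
  have h1 : ∑ σ, pfTerm X σ = ∑ σ, pfTerm (1 * X * 1ᵀ) σ := by simp
  rw [h1, sum_pfTerm_conj_eq_sum_det, sum_pfTerm_conj_eq_sum_det, Finset.mul_sum]
  refine Finset.sum_congr rfl fun g _ => ?_
  have : B.submatrix id (unpair g) =
      B * (1 : Matrix (Fin (2 * n)) (Fin (2 * n)) R).submatrix id (unpair g) := by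
    ext i j
    simp [Matrix.mul_apply, Matrix.one_apply]
  rw [this, Matrix.det_mul]
  ring

lemma pf_map {R S : Type*} [CommRing R] [CommRing S] (φ : R →+* S) {n : ℕ}
    (X : Matrix (Fin (2 * n)) (Fin (2 * n)) R) : pf (X.map φ) = φ (pf X) := by
  simp [pf, map_sum, map_prod]

lemma pf_conj_of_charZero {R : Type*} [CommRing R] [IsDomain R] [CharZero R] {n : ℕ}
    (B : Matrix (Fin (2 * n)) (Fin (2 * n)) R) {X : Matrix (Fin (2 * n)) (Fin (2 * n)) R}
    (hX : Xᵀ = -X) : pf (B * X * Bᵀ) = B.det * pf X := by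
  have hBX : (B * X * Bᵀ)ᵀ = -(B * X * Bᵀ) := by
    simp [Matrix.transpose_mul, hX, Matrix.mul_assoc]
  have h := sum_pfTerm_conj B X
  rw [sum_pfTerm hX, sum_pfTerm hBX] at h
  have hn : ((2 ^ n * n.factorial : ℕ) : R) ≠ 0 :=
    Nat.cast_ne_zero.2 (mul_ne_zero (by positivity) n.factorial_ne_zero)
  apply mul_left_cancel₀ hn
  rw [h]
  ring

/-- The Pfaffian of a congruent alternating matrix. -/
theorem pf_conj {R : Type*} [CommRing R] {n : ℕ}
    (B : Matrix (Fin (2 * n)) (Fin (2 * n)) R) {X : Matrix (Fin (2 * n)) (Fin (2 * n)) R}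
    (hX : Xᵀ = -X) (hdiag : ∀ i, X i i = 0) : pf (B * X * Bᵀ) = B.det * pf X := by
  let ι := Fin (2 * n) × Fin (2 * n)
  let x : ι → MvPolynomial (ι ⊕ ι) ℤ := fun q => MvPolynomial.X (Sum.inl q)
  let B' : Matrix (Fin (2 * n)) (Fin (2 * n)) (MvPolynomial (ι ⊕ ι) ℤ) :=
    Matrix.of fun i j => MvPolynomial.X (Sum.inr (i, j))
  let X' : Matrix (Fin (2 * n)) (Fin (2 * n)) (MvPolynomial (ι ⊕ ι) ℤ) :=
    Matrix.of fun i j => if i < j then x (i, j) else if j < i then -x (j, i) else 0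
  let φ : MvPolynomial (ι ⊕ ι) ℤ →+* R := MvPolynomial.eval₂Hom (Int.castRingHom R)
    (Sum.elim (fun q => X q.1 q.2) fun q => B q.1 q.2)
  have hX' : X'ᵀ = -X' := by
    ext1 i j
    rcases lt_trichotomy i j with h | rfl | h
    · simp [X', h, h.not_gt]
    · simp [X']
    · simp [X', h, h.not_gt]
  have hφB : B'.map φ = B := by
    ext1 i j
    simp [B', φ]
  have hφX : X'.map φ = X := by
    have hanti : ∀ i j, X j i = -X i j := fun i j => congrFun (congrFun hX i) j
    ext1 i j
    rcases lt_trichotomy i j with h | rfl | h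
    · simp [X', x, φ, h]
    · simp [X', hdiag]
    · simp [X', x, φ, h, h.not_gt, hanti i j]
  have h := congrArg φ (pf_conj_of_charZero B' hX')
  rw [map_mul, RingHom.map_det, ← pf_map, ← pf_map, Matrix.map_mul, Matrix.map_mul,
    Matrix.transpose_map, RingHom.mapMatrix_apply, hφB, hφX] at h
  exact h

/-- The Pfaffian only depends on the entries above the diagonal. -/
lemma pf_congr {R : Type*} [CommRing R] {n : ℕ} {X Y : Matrix (Fin (2 * n)) (Fin (2 * n)) R}
    (h : ∀ i j, i < j → X i j = Y i j) : pf X = pf Y := by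
  rw [pf_eq_sum_pfTerm, pf_eq_sum_pfTerm]
  refine Finset.sum_congr rfl fun σ hσ => ?_
  simp only [pfTerm]
  congr 1
  exact Finset.prod_congr rfl fun k _ => h _ _ ((mem_pfPerms.1 hσ).1 k)

lemma two_mul_lt_two_mul_succ (m : ℕ) : 2 * m < 2 * (m + 1) :=
  Nat.mul_lt_mul_of_pos_left (Nat.lt_succ_self m) Nat.two_pos

lemma two_mul_le_two_mul_succ (m : ℕ) : 2 * m ≤ 2 * (m + 1) :=
  (two_mul_lt_two_mul_succ m).le

lemma two_mul_add_one_lt_two_mul_succ (m : ℕ) : 2 * m + 1 < 2 * (m + 1) :=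
  Nat.lt_succ_self (2 * m + 1)

/-- The extension of a permutation of `Fin (2 * m)` fixing the last two points. -/
def extendPerm {m : ℕ} (σ : Equiv.Perm (Fin (2 * m))) : Equiv.Perm (Fin (2 * (m + 1))) :=
  (finSumFinEquiv : Fin (2 * m) ⊕ Fin 2 ≃ Fin (2 * (m + 1))).permCongr (Equiv.sumCongr σ 1)

lemma castLE_eq_finSumFinEquiv {m : ℕ} (h : 2 * m ≤ 2 * (m + 1)) (i : Fin (2 * m)) :
    Fin.castLE h i = (finSumFinEquiv : Fin (2 * m) ⊕ Fin 2 ≃ Fin (2 * (m + 1))) (Sum.inl i) :=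
  rfl

lemma pairPos_last {m : ℕ} (b : Fin 2) :
    pairPos (m + 1) (Fin.last m, b) =
      (finSumFinEquiv : Fin (2 * m) ⊕ Fin 2 ≃ Fin (2 * (m + 1))) (Sum.inr b) := by
  ext; simp [pairPos, finProdFinEquiv]; omega

lemma pairPos_castSucc {m : ℕ} (k : Fin m) (b : Fin 2) :
    pairPos (m + 1) (k.castSucc, b) = Fin.castLE (two_mul_le_two_mul_succ m) (pairPos m (k, b)) := by
  ext; simp [pairPos, finProdFinEquiv]

lemma extendPerm_castLE {m : ℕ} (σ : Equiv.Perm (Fin (2 * m))) (h : 2 * m ≤ 2 * (m + 1))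
    (i : Fin (2 * m)) : extendPerm σ (Fin.castLE h i) = Fin.castLE h (σ i) := by
  rw [castLE_eq_finSumFinEquiv, castLE_eq_finSumFinEquiv, extendPerm, Equiv.permCongr_apply,
    Equiv.symm_apply_apply]
  rfl

lemma extendPerm_pairPos_last {m : ℕ} (σ : Equiv.Perm (Fin (2 * m))) (b : Fin 2) :
    extendPerm σ (pairPos (m + 1) (Fin.last m, b)) = pairPos (m + 1) (Fin.last m, b) := by
  rw [pairPos_last, extendPerm, Equiv.permCongr_apply, Equiv.symm_apply_apply]
  rfl

lemma sign_extendPerm {m : ℕ} (σ : Equiv.Perm (Fin (2 * m))) :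
    Equiv.Perm.sign (extendPerm σ) = Equiv.Perm.sign σ := by
  rw [extendPerm, Equiv.Perm.sign_permCongr]
  exact (Equiv.Perm.sign_sumCongr σ 1).trans (by simp)

lemma extendPerm_injective {m : ℕ} :
    Function.Injective (extendPerm : Equiv.Perm (Fin (2 * m)) → _) := by
  intro σ τ h
  ext i
  have := congrArg Fin.val (Equiv.congr_fun h (Fin.castLE (two_mul_le_two_mul_succ m) i))
  simpa [extendPerm_castLE] using this

lemma exists_extendPerm_eq {m : ℕ} {σ : Equiv.Perm (Fin (2 * (m + 1)))}
    (h : ∀ b, σ (pairPos (m + 1) (Fin.last m, b)) = pairPos (m + 1) (Fin.last m, b)) :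
    ∃ τ, extendPerm τ = σ := by
  let e : Fin (2 * m) ⊕ Fin 2 ≃ Fin (2 * (m + 1)) := finSumFinEquiv
  let ρ : Equiv.Perm (Fin (2 * m) ⊕ Fin 2) := e.symm.permCongr σ
  have hρ : ∀ b, ρ (Sum.inr b) = Sum.inr b := by
    intro b
    have hb := h b
    rw [pairPos_last] at hb
    exact (Equiv.symm_apply_eq e).2 hb
  have hmaps : Set.MapsTo ρ (Set.range Sum.inl) (Set.range Sum.inl) := by
    rintro _ ⟨i, rfl⟩
    rcases hi : ρ (Sum.inl i) with j | b
    · exact ⟨j, rfl⟩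
    · exact absurd (ρ.injective (hi.trans (hρ b).symm)) (by simp)
  obtain ⟨⟨τ, τ'⟩, hτ⟩ := Equiv.Perm.mem_sumCongrHom_range_of_perm_mapsTo_inl hmaps
  have hτ' : τ' = 1 := by
    ext1 b
    have := hρ b
    rw [← hτ] at this
    simpa using this
  refine ⟨τ, ?_⟩
  subst hτ'
  have hσ : e.permCongr ρ = σ := by
    ext1 p
    simp [ρ, Equiv.permCongr_apply]
  rw [← hσ, ← hτ]
  rfl

lemma extendPerm_mem_pfPerms {m : ℕ} {σ : Equiv.Perm (Fin (2 * m))} :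
    extendPerm σ ∈ pfPerms (m + 1) ↔ σ ∈ pfPerms m := by
  have hlast : ∀ i : Fin (2 * m),
      Fin.castLE (two_mul_le_two_mul_succ m) i < pairPos (m + 1) (Fin.last m, 0) := by
    intro i
    rw [pairPos_zero, Fin.lt_def]
    exact i.2
  rw [mem_pfPerms, mem_pfPerms, Fin.forall_fin_succ']
  simp only [pairPos_castSucc, extendPerm_castLE, extendPerm_pairPos_last]
  constructor
  · rintro ⟨⟨h₁, -⟩, h₂⟩
    refine ⟨h₁, fun k l hkl => ?_⟩
    have := h₂ (Fin.castSucc_lt_castSucc_iff.2 hkl)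
    simp only [pairPos_castSucc, extendPerm_castLE] at this
    exact this
  · rintro ⟨h₁, h₂⟩
    refine ⟨⟨h₁, by simp [pairPos_zero, pairPos_one]⟩, fun k l hkl => ?_⟩
    induction k using Fin.lastCases with
    | last => exact absurd hkl (Fin.le_last l).not_gt
    | cast k =>
      induction l using Fin.lastCases with
      | last => simpa only [pairPos_castSucc, extendPerm_castLE, extendPerm_pairPos_last]
          using hlast _
      | cast l =>
        simp only [pairPos_castSucc, extendPerm_castLE]
        exact h₂ (Fin.castSucc_lt_castSucc_iff.1 hkl)

/-- If the last column vanishes above the last pair, the last pair splits off the Pfaffian. -/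
lemma pf_of_last_col_eq_zero {R : Type*} [CommRing R] {m : ℕ}
    (Y : Matrix (Fin (2 * (m + 1))) (Fin (2 * (m + 1))) R)
    (hY : ∀ i : Fin (2 * m), Y (Fin.castLE (two_mul_le_two_mul_succ m) i)
      ⟨2 * m + 1, two_mul_add_one_lt_two_mul_succ m⟩ = 0) :
    pf Y = Y ⟨2 * m, two_mul_lt_two_mul_succ m⟩ ⟨2 * m + 1, two_mul_add_one_lt_two_mul_succ m⟩ *
      pf (Y.submatrix (Fin.castLE (two_mul_le_two_mul_succ m))
        (Fin.castLE (two_mul_le_two_mul_succ m)) :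
        Matrix (Fin (2 * m)) (Fin (2 * m)) R) := by
  rw [pf_eq_sum_pfTerm, pf_eq_sum_pfTerm, Finset.mul_sum]
  symm
  refine Finset.sum_of_injOn extendPerm extendPerm_injective.injOn
    (fun σ hσ => extendPerm_mem_pfPerms.2 hσ) ?_ ?_
  · intro σ hσ himage
    have hp := mem_pfPerms.1 hσ
    by_contra hterm
    have hfac : ∀ k, Y (σ (pairPos (m + 1) (k, 0))) (σ (pairPos (m + 1) (k, 1))) ≠ 0 := by
      intro k hk
      exact hterm (by rw [pfTerm, Finset.prod_eq_zero (Finset.mem_univ k) hk, smul_zero])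
    obtain ⟨⟨k, b⟩, hkb⟩ := (pairPos (m + 1)).surjective
      (σ.symm ⟨2 * m + 1, two_mul_add_one_lt_two_mul_succ m⟩)
    rw [Equiv.eq_symm_apply] at hkb
    have hk1 : σ (pairPos (m + 1) (k, 1)) = ⟨2 * m + 1, two_mul_add_one_lt_two_mul_succ m⟩ := by
      fin_cases b
      · have h1 := hp.1 k
        have h2 := (σ (pairPos (m + 1) (k, 1))).2
        simp only [Fin.zero_eta] at hkb
        rw [hkb, Fin.lt_def] at h1
        simp only at h1
        omega
      · exact hkb
    have hlt : ∀ l, σ (pairPos (m + 1) (l, 0)) < ⟨2 * m + 1, two_mul_add_one_lt_two_mul_succ m⟩ := by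
      intro l
      refine (hp.1 l).trans_le ?_
      rw [Fin.le_def]
      have := (σ (pairPos (m + 1) (l, 1))).2
      simp only
      omega
    have hk0 : σ (pairPos (m + 1) (k, 0)) = ⟨2 * m, two_mul_lt_two_mul_succ m⟩ := by
      by_contra hne
      have h1 := hlt k
      rw [Fin.lt_def] at h1
      rw [Fin.ext_iff] at hne
      simp only at h1 hne
      refine hfac k ?_
      rw [hk1]
      exact hY ⟨(σ (pairPos (m + 1) (k, 0))).1, by omega⟩
    obtain rfl : k = Fin.last m := by
      by_contra hne
      have h1 := hp.2 (lt_of_le_of_ne (Fin.le_last k) hne)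
      have h2 := hlt (Fin.last m)
      simp only [hk0] at h1
      rw [Fin.lt_def] at h1 h2
      simp only at h1 h2
      omega
    obtain ⟨τ, rfl⟩ : ∃ τ, extendPerm τ = σ := by
      refine exists_extendPerm_eq (Fin.forall_fin_two.2 ⟨?_, ?_⟩)
      · rw [hk0, pairPos_zero]; rfl
      · rw [hk1, pairPos_one]; rfl
    exact himage ⟨τ, extendPerm_mem_pfPerms.1 hσ, rfl⟩
  · intro σ _
    simp only [pfTerm, sign_extendPerm, Fin.prod_univ_castSucc, pairPos_castSucc,
      extendPerm_castLE, extendPerm_pairPos_last, Matrix.submatrix_apply]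
    rw [mul_smul_comm, pairPos_zero, pairPos_one]
    exact congrArg _ (mul_comm _ _)

/-- The transvection-like matrix adding `a i` times row `p` to row `i`. -/
def addRowMatrix {R : Type*} [CommRing R] {N : ℕ} (p : Fin N) (a : Fin N → R) :
    Matrix (Fin N) (Fin N) R :=
  1 + Matrix.vecMulVec a (Pi.single p 1)

lemma det_addRowMatrix {R : Type*} [CommRing R] {N : ℕ} {p : Fin N} {a : Fin N → R}
    (ha : a p = 0) : (addRowMatrix p a).det = 1 := by
  rw [addRowMatrix, Matrix.vecMulVec_eq Unit, Matrix.det_one_add_replicateCol_mul_replicateRow]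
  simp [ha]

lemma addRowMatrix_conj_apply {R : Type*} [CommRing R] {N : ℕ} (p : Fin N) (a : Fin N → R)
    (X : Matrix (Fin N) (Fin N) R) (i j : Fin N) :
    (addRowMatrix p a * X * (addRowMatrix p a)ᵀ) i j =
      X i j + a i * X p j + a j * X i p + a i * a j * X p p := by
  simp [addRowMatrix, Matrix.mul_apply, Matrix.add_apply, Matrix.vecMulVec_apply,
    Matrix.one_apply, Pi.single_apply, add_mul, mul_add, Finset.sum_add_distrib]
  ring

/-- Rank-2 reduction of a Pfaffian: if the bottom-right `2×2` block of an
antisymmetric `2m × 2m` matrix `X` is `[[0,s],[-s,0]]` with `s` invertible, and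
`u, v` are the last two columns restricted to the first `2(m-1)` rows, then
`Pf[X] = s · Pf[A']` where `A'_{ij} = A_{ij} - (u_i v_j - v_i u_j)/s`. -/
theorem pf_rank_two_reduction {R : Type*} [CommRing R] (m : ℕ)
    (X : Matrix (Fin (2 * (m + 1))) (Fin (2 * (m + 1))) R) (hX : Xᵀ = -X)
    (s : R) [Invertible s]
    (hs : X ⟨2 * m, by omega⟩ ⟨2 * m + 1, by omega⟩ = s) :
    pf X = s * pf (fun i j : Fin (2 * m) =>
      X (Fin.castLE (by omega) i) (Fin.castLE (by omega) j) -
        (X (Fin.castLE (by omega) i) ⟨2 * m, by omega⟩ *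
            X (Fin.castLE (by omega) j) ⟨2 * m + 1, by omega⟩ -
          X (Fin.castLE (by omega) i) ⟨2 * m + 1, by omega⟩ *
            X (Fin.castLE (by omega) j) ⟨2 * m, by omega⟩) * ⅟s) := by
  have hanti : ∀ i j, X j i = -X i j := fun i j => congrFun (congrFun hX i) j
  set p : Fin (2 * (m + 1)) := ⟨2 * m, two_mul_lt_two_mul_succ m⟩ with hp
  set q : Fin (2 * (m + 1)) := ⟨2 * m + 1, two_mul_add_one_lt_two_mul_succ m⟩ with hq
  have hpq : p ≠ q := by simp [hp, hq]
  let Z : Matrix (Fin (2 * (m + 1))) (Fin (2 * (m + 1))) R :=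
    Matrix.of fun i j => if i = j then 0 else X i j
  have hZ : ∀ {i j}, i ≠ j → Z i j = X i j := fun h => if_neg h
  have hZdiag : ∀ i, Z i i = 0 := fun i => if_pos rfl
  have hZanti : Zᵀ = -Z := by
    ext i j
    by_cases h : i = j
    · simp [h, hZdiag]
    · simpa [hZ h, hZ (Ne.symm h)] using hanti i j
  let a : Fin (2 * (m + 1)) → R := fun i => if i < p then -(X i q * ⅟s) else 0
  have hcast : ∀ i : Fin (2 * m), Fin.castLE (two_mul_le_two_mul_succ m) i < p := fun i => i.2
  have hcastq : ∀ i : Fin (2 * m), Fin.castLE (two_mul_le_two_mul_succ m) i ≠ q := fun i =>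
    ((hcast i).trans (Fin.lt_def.2 (Nat.lt_succ_self _))).ne
  have ha : ∀ i : Fin (2 * m), a (Fin.castLE (two_mul_le_two_mul_succ m) i) =
      -(X (Fin.castLE (two_mul_le_two_mul_succ m) i) q * ⅟s) := fun i => if_pos (hcast i)
  have hap : a p = 0 := if_neg (lt_irrefl p)
  have haq : a q = 0 := if_neg (Fin.lt_def.2 (Nat.lt_succ_self _)).not_gt
  have hsinv : ⅟s * s = 1 := invOf_mul_self s
  rw [pf_congr (Y := Z) fun i j hij => (hZ hij.ne).symm, ← one_mul (pf Z),
    ← det_addRowMatrix hap, ← pf_conj _ hZanti hZdiag, pf_of_last_col_eq_zero]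
  · congr 1
    · rw [addRowMatrix_conj_apply, ← hp, ← hq, hap, haq, hZ hpq, hs]
      ring
    · refine pf_congr fun i j hij => ?_
      have hij' : (Fin.castLE (two_mul_le_two_mul_succ m) i : Fin (2 * (m + 1))) ≠
          Fin.castLE (two_mul_le_two_mul_succ m) j :=
        fun h => hij.ne (Fin.castLE_injective _ h)
      rw [Matrix.submatrix_apply, addRowMatrix_conj_apply, ha, ha, hZdiag, hZ hij',
        hZ (hcast i).ne, hZ (hcast j).ne', hanti (Fin.castLE _ j) p]
      ring
  · intro i
    rw [addRowMatrix_conj_apply, ← hq, ha, haq, hZ hpq, hZ (hcastq i), hs]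
    linear_combination (-X (Fin.castLE (two_mul_le_two_mul_succ m) i) q) * hsinv
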